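/- There exists a constant C > 0 such that the following holds for every n ≥ 2, every connected initial graph G₀ on n vertices, and every vertex u. Let T = ⌈C·n·ln n⌉. Then the probability (over the trajectory of the two-hop walk process started at G₀) of the event that both |N_T²(u)| < δ₀/2 and d_T(u) < min{2δ₀, n − 1}, is at most 1/n². -/

import Mathlib

open scoped Classical

noncomputable section

variable {V : Type} [Fintype V] [DecidableEq V]

/-- The neighbors of `v` in `G`, as a `Finset`. -/
def nbr (G : SimpleGraph V) (v : V) : Finset V := Finset.univ.filter (fun w => G.Adj v w)

/-- The degree `d(v)` of `v` in `G`. -/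
def deg (G : SimpleGraph V) (v : V) : ℕ := (nbr G v).card

/-- The minimum degree of `G`. -/
def minDeg (G : SimpleGraph V) : ℕ := sInf (Set.range (deg G))

/-- `Nk G u i` is the set `Nⁱ(u)` of vertices at graph distance exactly `i` from `u`. -/
def Nk (G : SimpleGraph V) (u : V) (i : ℕ) : Finset V :=
  Finset.univ.filter (fun v => v ≠ u ∧ G.dist u v = i)

/-- `degIn G v S` is `d(v, S)`, the number of neighbors of `v` lying in `S`. -/
def degIn (G : SimpleGraph V) (v : V) (S : Finset V) : ℕ := (nbr G v ∩ S).card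

/-- The graph obtained from a choice function `c` in one round of the triangulation
process: every vertex `w` adds the edge joining the ordered pair `c w` of its chosen
neighbors (edges are unordered, loops are discarded, all additions are simultaneous). -/
def triNext (G : SimpleGraph V) (c : V → V × V) : SimpleGraph V :=
  G ⊔ SimpleGraph.fromEdgeSet {e | ∃ v : V, e = s((c v).1, (c v).2)}

/-- The probability that in one round of the triangulation process on the current
graph `G` the vertices make exactly the choices recorded by `c`: each vertex with at
least one neighbor independently picks an ordered pair of its neighbors uniformly at
random with replacement; isolated vertices are given the dummy choice `(v, v)`. -/
def triWeight (G : SimpleGraph V) (c : V → V × V) : ℝ :=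
  ∏ v : V,
    if deg G v = 0 then (if c v = (v, v) then 1 else 0)
    else if (c v).1 ∈ nbr G v ∧ (c v).2 ∈ nbr G v then (1 : ℝ) / (deg G v : ℝ) ^ 2 else 0

/-- Transition probability of one round of the triangulation process. -/
def triStep (G G' : SimpleGraph V) : ℝ :=
  ∑ c : V → V × V, if triNext G c = G' then triWeight G c else 0

/-- The graph obtained from a choice function `c` in one round of the two-hop walk
process: every vertex `u` adds the edge to the endpoint `(c u).2` of its two-hop walk
(loops are discarded, all additions are simultaneous). -/
def hopNext (G : SimpleGraph V) (c : V → V × V) : SimpleGraph V :=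
  G ⊔ SimpleGraph.fromEdgeSet {e | ∃ u : V, e = s(u, (c u).2)}

/-- The probability that in one round of the two-hop walk process on the current graph
`G` the vertices make exactly the choices recorded by `c`: each vertex `u` with at
least one neighbor independently picks a uniformly random neighbor `v = (c u).1` and
then a uniformly random neighbor `w = (c u).2` of `v`; isolated vertices are given the
dummy choice `(u, u)`. -/
def hopWeight (G : SimpleGraph V) (c : V → V × V) : ℝ :=
  ∏ u : V,
    if deg G u = 0 then (if c u = (u, u) then 1 else 0)
    else if (c u).1 ∈ nbr G u ∧ (c u).2 ∈ nbr G (c u).1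
      then (1 : ℝ) / ((deg G u : ℝ) * (deg G (c u).1 : ℝ)) else 0

/-- Transition probability of one round of the two-hop walk process. -/
def hopStep (G G' : SimpleGraph V) : ℝ :=
  ∑ c : V → V × V, if hopNext G c = G' then hopWeight G c else 0

/-- `trajProb step g0 T E` is the probability, for the Markov chain on a finite state
space `Γ` with one-step transition probabilities `step` started at `g0`, that the
trajectory `(g_0, g_1, …, g_T)` satisfies the event `E`; probabilities are realized as
a probability mass function on finite sequences of states.  (The trajectory is passed
to `E` as a function on `ℕ`, frozen at time `T`.) -/
def trajProb {Γ : Type} [Fintype Γ] (step : Γ → Γ → ℝ) (g0 : Γ) (T : ℕ)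
    (E : (ℕ → Γ) → Prop) : ℝ :=
  ∑ s : Fin (T + 1) → Γ,
    if s 0 = g0 ∧ E (fun t => s ⟨min t T, Nat.lt_succ_of_le (Nat.min_le_right t T)⟩)
    then ∏ t : Fin T, step (s t.castSucc) (s t.succ) else 0

end

noncomputable section

set_option linter.unusedSectionVars false

variable {V : Type} [Fintype V] [DecidableEq V]

/-! ### One round of the process as an averaging operator -/

/-- The law of the two-hop walk of a single vertex `u`. -/
def walkWeight (G : SimpleGraph V) (u : V) (p : V × V) : ℝ :=
  if deg G u = 0 then (if p = (u, u) then 1 else 0)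
    else if p.1 ∈ nbr G u ∧ p.2 ∈ nbr G p.1
      then (1 : ℝ) / ((deg G u : ℝ) * (deg G p.1 : ℝ)) else 0

/-- The expectation of `f` after one round started at `G`. -/
def hopMean (f : SimpleGraph V → ℝ) (G : SimpleGraph V) : ℝ :=
  ∑ c : V → V × V, hopWeight G c * f (hopNext G c)

/-- The real-valued indicator of a predicate on graphs. -/
def indic (E : SimpleGraph V → Prop) (G : SimpleGraph V) : ℝ := if E G then 1 else 0

theorem mem_nbr {G : SimpleGraph V} {v w : V} : w ∈ nbr G v ↔ G.Adj v w := by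
  simp [nbr]

theorem nbr_mono {G G' : SimpleGraph V} (h : G ≤ G') (v : V) : nbr G v ⊆ nbr G' v :=
  fun _ hw => mem_nbr.2 (h (mem_nbr.1 hw))

theorem deg_pos_of_adj {G : SimpleGraph V} {v w : V} (h : G.Adj v w) : 0 < deg G v :=
  Finset.card_pos.2 ⟨w, mem_nbr.2 h⟩

theorem deg_le_card (G : SimpleGraph V) (v : V) : deg G v ≤ Fintype.card V :=
  Finset.card_le_univ _

theorem walkWeight_nonneg (G : SimpleGraph V) (u : V) (p : V × V) : 0 ≤ walkWeight G u p := by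
  unfold walkWeight
  split_ifs <;> positivity

theorem sum_walkWeight_mul {G : SimpleGraph V} {u : V} (hu : deg G u ≠ 0) (g : V × V → ℝ) :
    ∑ p, walkWeight G u p * g p =
      ∑ a ∈ nbr G u, ∑ b ∈ nbr G a, 1 / ((deg G u : ℝ) * (deg G a : ℝ)) * g (a, b) := by
  rw [Fintype.sum_prod_type]
  rw [← Finset.sum_subset (Finset.subset_univ (nbr G u))]
  · refine Finset.sum_congr rfl fun a ha => ?_
    rw [← Finset.sum_subset (Finset.subset_univ (nbr G a))]
    · refine Finset.sum_congr rfl fun b hb => ?_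
      simp [walkWeight, hu, ha, hb]
    · intro b _ hb
      simp [walkWeight, hu, hb]
  · intro a _ ha
    exact Finset.sum_eq_zero fun b _ => by simp [walkWeight, hu, ha]

theorem sum_walkWeight (G : SimpleGraph V) (u : V) : ∑ p, walkWeight G u p = 1 := by
  by_cases hu : deg G u = 0
  · simp [walkWeight, hu]
  · have h := sum_walkWeight_mul hu (fun _ => 1)
    simp only [mul_one] at h
    rw [h]
    have hu' : (deg G u : ℝ) ≠ 0 := by exact_mod_cast hu
    have : ∀ a ∈ nbr G u, ∑ _b ∈ nbr G a, 1 / ((deg G u : ℝ) * (deg G a : ℝ))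
        = 1 / (deg G u : ℝ) := by
      intro a ha
      have ha' : (deg G a : ℝ) ≠ 0 := by
        exact_mod_cast (deg_pos_of_adj (mem_nbr.1 ha).symm).ne'
      rw [Finset.sum_const, nsmul_eq_mul]
      change (deg G a : ℝ) * _ = _
      field_simp
    rw [Finset.sum_congr rfl this, Finset.sum_const, nsmul_eq_mul]
    change (deg G u : ℝ) * _ = _
    field_simp

theorem hopWeight_eq (G : SimpleGraph V) (c : V → V × V) :
    hopWeight G c = ∏ v, walkWeight G v (c v) := rfl

theorem hopWeight_nonneg (G : SimpleGraph V) (c : V → V × V) : 0 ≤ hopWeight G c :=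
  Finset.prod_nonneg fun v _ => walkWeight_nonneg G v (c v)

/-- The marginal of the joint choice at a single vertex. -/
theorem sum_hopWeight_mul (G : SimpleGraph V) (w : V) (g : V × V → ℝ) :
    ∑ c : V → V × V, hopWeight G c * g (c w) = ∑ p, walkWeight G w p * g p := by
  have h1 : ∀ c : V → V × V, hopWeight G c * g (c w) =
      ∏ v, (walkWeight G v (c v) * if v = w then g (c v) else 1) := by
    intro c
    rw [Finset.prod_mul_distrib, Finset.prod_ite_eq' Finset.univ w, hopWeight_eq]
    simp
  have h2 := Finset.prod_univ_sum (fun _ : V => (Finset.univ : Finset (V × V)))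
    (fun v p => walkWeight G v p * if v = w then g p else 1)
  rw [Fintype.piFinset_univ] at h2
  rw [Finset.sum_congr rfl fun c _ => h1 c, ← h2, Finset.prod_eq_single w]
  · simp
  · intro v _ hv
    simp [hv, sum_walkWeight]
  · simp

theorem sum_hopWeight [Nonempty V] (G : SimpleGraph V) : ∑ c, hopWeight G c = 1 := by
  have h := sum_hopWeight_mul G (Classical.arbitrary V) (fun _ => 1)
  simpa [sum_walkWeight] using h

theorem le_hopNext (G : SimpleGraph V) (c : V → V × V) : G ≤ hopNext G c := le_sup_left

theorem hopNext_adj (G : SimpleGraph V) (c : V → V × V) {w : V} (h : w ≠ (c w).2) :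
    (hopNext G c).Adj w (c w).2 := by
  refine (le_sup_right : _ ≤ hopNext G c) ?_
  rw [SimpleGraph.fromEdgeSet_adj]
  exact ⟨⟨w, rfl⟩, h⟩

theorem hopMean_mono {G : SimpleGraph V} {f g : SimpleGraph V → ℝ}
    (h : ∀ G', G ≤ G' → f G' ≤ g G') : hopMean f G ≤ hopMean g G :=
  Finset.sum_le_sum fun c _ =>
    mul_le_mul_of_nonneg_left (h _ (le_hopNext G c)) (hopWeight_nonneg G c)

theorem iterate_hopMean_mono {f g : SimpleGraph V → ℝ} (t : ℕ) {G : SimpleGraph V}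
    (h : ∀ G', G ≤ G' → f G' ≤ g G') : hopMean^[t] f G ≤ hopMean^[t] g G := by
  induction t generalizing G with
  | zero => exact h G le_rfl
  | succ t ih =>
    rw [Function.iterate_succ_apply', Function.iterate_succ_apply']
    exact hopMean_mono fun G' hG' => ih fun G'' h'' => h G'' (hG'.trans h'')

theorem iterate_hopMean_const [Nonempty V] (t : ℕ) (b : ℝ) (G : SimpleGraph V) :
    hopMean^[t] (fun _ => b) G = b := by
  induction t generalizing G with
  | zero => rfl
  | succ t ih =>
    rw [Function.iterate_succ_apply', hopMean]
    simp only [ih]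
    rw [← Finset.sum_mul, sum_hopWeight, one_mul]

theorem hopMean_add (f g : SimpleGraph V → ℝ) :
    hopMean (fun G => f G + g G) = fun G => hopMean f G + hopMean g G := by
  funext G
  simp only [hopMean, mul_add, Finset.sum_add_distrib]

theorem hopMean_const_mul (a : ℝ) (f : SimpleGraph V → ℝ) :
    hopMean (fun G => a * f G) = fun G => a * hopMean f G := by
  funext G
  simp only [hopMean, Finset.mul_sum]
  exact Finset.sum_congr rfl fun c _ => by ring

theorem hopMean_sum {ι : Type} (s : Finset ι) (f : ι → SimpleGraph V → ℝ) :
    hopMean (fun G => ∑ i ∈ s, f i G) = fun G => ∑ i ∈ s, hopMean (f i) G := by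
  funext G
  simp only [hopMean, Finset.mul_sum]
  exact Finset.sum_comm

theorem iterate_hopMean_add (t : ℕ) (f g : SimpleGraph V → ℝ) :
    hopMean^[t] (fun G => f G + g G) = fun G => hopMean^[t] f G + hopMean^[t] g G := by
  induction t with
  | zero => rfl
  | succ t ih => simp only [Function.iterate_succ_apply', ih, hopMean_add]

theorem iterate_hopMean_const_mul (t : ℕ) (a : ℝ) (f : SimpleGraph V → ℝ) :
    hopMean^[t] (fun G => a * f G) = fun G => a * hopMean^[t] f G := by
  induction t with
  | zero => rfl
  | succ t ih => simp only [Function.iterate_succ_apply', ih, hopMean_const_mul]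

theorem iterate_hopMean_sum {ι : Type} (t : ℕ) (s : Finset ι) (f : ι → SimpleGraph V → ℝ) :
    hopMean^[t] (fun G => ∑ i ∈ s, f i G) = fun G => ∑ i ∈ s, hopMean^[t] (f i) G := by
  induction t with
  | zero => rfl
  | succ t ih => simp only [Function.iterate_succ_apply', ih, hopMean_sum]

/-- A function contracted by every round decays geometrically. -/
theorem iterate_hopMean_le_pow {H : SimpleGraph V} {φ : SimpleGraph V → ℝ} {r : ℝ} (hr : 0 ≤ r)
    (h : ∀ G, H ≤ G → hopMean φ G ≤ r * φ G) (t : ℕ) :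
    ∀ G, H ≤ G → hopMean^[t] φ G ≤ r ^ t * φ G := by
  induction t with
  | zero => intro G _; simp
  | succ t ih =>
    intro G hG
    rw [Function.iterate_succ_apply']
    calc hopMean (hopMean^[t] φ) G ≤ hopMean (fun G => r ^ t * φ G) G :=
          hopMean_mono fun G' hG' => ih G' (hG.trans hG')
      _ = r ^ t * hopMean φ G := by rw [hopMean_const_mul]
      _ ≤ r ^ t * (r * φ G) := by gcongr; exact h G hG
      _ = r ^ (t + 1) * φ G := by ring

theorem sum_hopStep_mul (f : SimpleGraph V → ℝ) (G : SimpleGraph V) :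
    ∑ G', hopStep G G' * f G' = hopMean f G := by
  simp only [hopStep, hopMean, Finset.sum_mul]
  rw [Finset.sum_comm]
  refine Finset.sum_congr rfl fun c _ => ?_
  simp [ite_mul]

/-- Markov property: conditioning a trajectory on its first step. -/
theorem trajProb_succ {Γ : Type} [Fintype Γ] (step : Γ → Γ → ℝ) (g : Γ) (T : ℕ)
    (E : Γ → Prop) :
    trajProb step g (T + 1) (fun s => E (s (T + 1))) =
      ∑ g', step g g' * trajProb step g' T (fun s => E (s T)) := by
  unfold trajProb
  have hl : ∀ T : ℕ, ∀ h : min T T < T + 1, (⟨min T T, h⟩ : Fin (T + 1)) = Fin.last T := by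
    intro T h; ext; simp
  simp only [hl]
  rw [← (Fin.consEquiv (fun _ : Fin (T + 2) => Γ)).sum_comp, Fintype.sum_prod_type,
    Finset.sum_eq_single g]
  · simp only [Finset.mul_sum]
    rw [Finset.sum_comm]
    refine Finset.sum_congr rfl fun s _ => ?_
    rw [Finset.sum_eq_single (s 0)]
    · rw [Fin.prod_univ_succ]
      simp [Fin.consEquiv, ← Fin.succ_last]
    · intro b _ hb
      simp [hb.symm]
    · simp
  · intro b _ hb
    refine Finset.sum_eq_zero fun s _ => ?_
    simp [Fin.consEquiv, hb]
  · simp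

theorem trajProb_hopStep (T : ℕ) (E : SimpleGraph V → Prop) (G : SimpleGraph V) :
    trajProb hopStep G T (fun g => E (g T)) = hopMean^[T] (indic E) G := by
  induction T generalizing G with
  | zero =>
    unfold trajProb
    rw [← (Equiv.funUnique (Fin 1) (SimpleGraph V)).symm.sum_comp, Finset.sum_eq_single G]
    · simp [indic, Equiv.funUnique]
    · intro b _ hb
      simp [Equiv.funUnique, hb]
    · simp
  | succ T ih =>
    rw [trajProb_succ, Function.iterate_succ_apply', ← sum_hopStep_mul]
    simp only [ih]

/-- If the walk of `w` hits `X` with probability at least `q`, and hitting `X` lowers `f`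
from `a` to `b`, then one round lowers the mean of `f` accordingly. -/
theorem hopMean_le_of_hit [Nonempty V] {G : SimpleGraph V} {w : V} {X : Finset V}
    {f : SimpleGraph V → ℝ} {a b q : ℝ} (hba : b ≤ a) (ha : ∀ G', G ≤ G' → f G' ≤ a)
    (hb : ∀ G', G ≤ G' → ∀ x ∈ X, G'.Adj w x → f G' ≤ b) (hwX : w ∉ X)
    (hq : q ≤ ∑ p, walkWeight G w p * if p.2 ∈ X then 1 else 0) :
    hopMean f G ≤ a - q * (a - b) := by
  have h1 : hopMean f G ≤
      ∑ c, hopWeight G c * (a - (a - b) * if (c w).2 ∈ X then 1 else 0) := by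
    refine Finset.sum_le_sum fun c _ => mul_le_mul_of_nonneg_left ?_ (hopWeight_nonneg G c)
    split_ifs with h
    · have := hb _ (le_hopNext G c) _ h (hopNext_adj G c fun hw => hwX (hw ▸ h))
      linarith
    · have := ha _ (le_hopNext G c)
      linarith
  have h2 := sum_hopWeight_mul G w (fun p => a - (a - b) * if p.2 ∈ X then 1 else 0)
  simp only [mul_sub (walkWeight G w _), Finset.sum_sub_distrib, ← Finset.sum_mul,
    sum_walkWeight, mul_left_comm (walkWeight G w _), ← Finset.mul_sum] at h2
  have : (a - b) * q ≤ (a - b) * ∑ p, walkWeight G w p * if p.2 ∈ X then 1 else 0 :=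
    mul_le_mul_of_nonneg_left hq (by linarith)
  linarith

/-- A lower bound for the probability that the two-hop walk of `w` ends in `X`. -/
theorem le_sum_walkWeight {G : SimpleGraph V} {w : V} {K X : Finset V} {D x : ℝ}
    (hK : K ⊆ nbr G w) (hx : 0 ≤ x)
    (hD : ∀ v ∈ K, (deg G v : ℝ) ≤ D) (hX : ∀ v ∈ K, x ≤ ((nbr G v ∩ X).card : ℝ)) :
    K.card * x / (Fintype.card V * D) ≤
      ∑ p, walkWeight G w p * if p.2 ∈ X then 1 else 0 := by
  rcases K.eq_empty_or_nonempty with rfl | ⟨v₀, hv₀⟩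
  · simp only [Finset.card_empty, Nat.cast_zero, zero_mul, zero_div]
    exact Finset.sum_nonneg fun p _ =>
      mul_nonneg (walkWeight_nonneg G w p) (by split_ifs <;> norm_num)
  have hw := deg_pos_of_adj (mem_nbr.1 (hK hv₀))
  rw [sum_walkWeight_mul hw.ne']
  have hw' : (0 : ℝ) < deg G w := by exact_mod_cast hw
  have hn : (deg G w : ℝ) ≤ Fintype.card V := by exact_mod_cast deg_le_card G w
  calc (K.card : ℝ) * x / (Fintype.card V * D)
      = ∑ v ∈ K, x / (Fintype.card V * D) := by
        rw [Finset.sum_const, nsmul_eq_mul, mul_div_assoc]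
    _ ≤ ∑ a ∈ K, ∑ b ∈ nbr G a,
          1 / ((deg G w : ℝ) * (deg G a : ℝ)) * (if b ∈ X then 1 else 0) := by
        refine Finset.sum_le_sum fun v hv => ?_
        have hv' : (0 : ℝ) < deg G v := by
          exact_mod_cast deg_pos_of_adj (mem_nbr.1 (hK hv)).symm
        rw [← Finset.mul_sum, Finset.sum_boole, Finset.filter_mem_eq_inter, div_eq_mul_one_div,
          mul_comm]
        have := hD v hv
        have := hX v hv
        gcongr
    _ ≤ _ := by
        refine Finset.sum_le_sum_of_subset_of_nonneg hK fun a _ _ => ?_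
        refine Finset.sum_nonneg fun b _ => mul_nonneg (by positivity) ?_
        split_ifs <;> norm_num

/-! ### Growth of neighborhoods inside a small ball -/

/-- The vertices reached from `u` by a walk of length one or two. -/
def reach2 (G : SimpleGraph V) (u : V) : Finset V :=
  nbr G u ∪ (nbr G u).biUnion (nbr G)

/-- The ball of radius two around `u` has at most `4 * d` vertices. -/
def SmallBall (u : V) (d : ℕ) (G : SimpleGraph V) : Prop := (reach2 G u).card ≤ 4 * d

/-- There is a potential witnessing that, as long as the ball around `u` stays small, `Q`
holds after a few rounds started from `H`. -/
def Decays (u : V) (d : ℕ) (H : SimpleGraph V) (Q : SimpleGraph V → Prop) : Prop :=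
  ∃ φ : SimpleGraph V → ℝ, (∀ G, 0 ≤ φ G) ∧ φ H ≤ 1 ∧
    (∀ G, H ≤ G → hopMean φ G ≤ (1 - 1 / (160 * Fintype.card V)) * φ G) ∧
    ∀ G, H ≤ G → SmallBall u d G → ¬ Q G → 1 / (Fintype.card V : ℝ) ≤ φ G

theorem mem_reach2 {G : SimpleGraph V} {u w : V} :
    w ∈ reach2 G u ↔ G.Adj u w ∨ ∃ v, G.Adj u v ∧ G.Adj v w := by
  simp [reach2, mem_nbr]

theorem reach2_mono {G G' : SimpleGraph V} (h : G ≤ G') (u : V) :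
    reach2 G u ⊆ reach2 G' u := by
  intro w hw
  rw [mem_reach2] at hw ⊢
  rcases hw with hw | ⟨v, h1, h2⟩
  · exact Or.inl (h hw)
  · exact Or.inr ⟨v, h h1, h h2⟩

theorem SmallBall.anti {u : V} {d : ℕ} {G G' : SimpleGraph V} (h : G ≤ G')
    (hs : SmallBall u d G') : SmallBall u d G :=
  (Finset.card_le_card (reach2_mono h u)).trans hs

theorem SmallBall.deg_le {u : V} {d : ℕ} {G : SimpleGraph V} (hs : SmallBall u d G) {v : V}
    (hv : G.Adj u v ∨ v = u) : deg G v ≤ 4 * d := by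
  refine (Finset.card_le_card fun w hw => ?_).trans hs
  rw [mem_nbr] at hw
  rw [mem_reach2]
  rcases hv with hv | rfl
  · exact Or.inr ⟨v, hv, hw⟩
  · exact Or.inl hw

theorem one_sub_rate_nonneg [Nonempty V] : (0 : ℝ) ≤ 1 - 1 / (160 * Fintype.card V) := by
  have : (1 : ℝ) ≤ Fintype.card V := by exact_mod_cast Fintype.card_pos
  rw [sub_nonneg, div_le_one (by positivity)]
  linarith

theorem Decays.of_holds {u : V} {d : ℕ} {H : SimpleGraph V} {Q : SimpleGraph V → Prop}
    (h : ∀ G, H ≤ G → Q G) : Decays u d H Q :=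
  ⟨fun _ => 0, fun _ => le_rfl, zero_le_one, fun G _ => by simp [hopMean],
    fun G hG _ hQ => absurd (h G hG) hQ⟩

theorem Decays.of_hit [Nonempty V] {u : V} {d : ℕ} {H : SimpleGraph V} {w : V} {X : Finset V}
    (hwX : w ∉ X)
    (h : ∀ G, H ≤ G → SmallBall u d G → 1 / (160 * (Fintype.card V : ℝ)) ≤
      ∑ p, walkWeight G w p * if p.2 ∈ X then 1 else 0) :
    Decays u d H fun G => ∃ x ∈ X, G.Adj w x := by
  have hn : (1 : ℝ) ≤ Fintype.card V := by exact_mod_cast Fintype.card_pos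
  refine ⟨indic fun G => SmallBall u d G ∧ ¬ ∃ x ∈ X, G.Adj w x, ?_, ?_, ?_, ?_⟩
  · intro G; unfold indic; split_ifs <;> norm_num
  · unfold indic; split_ifs <;> norm_num
  · intro G hG
    by_cases hQ : SmallBall u d G ∧ ¬ ∃ x ∈ X, G.Adj w x
    · have := hopMean_le_of_hit (f := indic fun G => SmallBall u d G ∧ ¬ ∃ x ∈ X, G.Adj w x)
        (zero_le_one) (fun G' _ => by unfold indic; split_ifs <;> norm_num)
        (fun G' _ x hx hadj => by
          unfold indic
          rw [if_neg fun hh => hh.2 ⟨x, hx, hadj⟩]) hwX (h G hG hQ.1)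
      refine this.trans ?_
      unfold indic
      rw [if_pos hQ]
      linarith
    · have h0 : indic (fun G => SmallBall u d G ∧ ¬ ∃ x ∈ X, G.Adj w x) G = 0 := if_neg hQ
      rw [h0, mul_zero]
      refine (hopMean_mono (g := fun _ => 0) fun G' hG' => ?_).trans (by simp [hopMean])
      unfold indic
      rw [if_neg]
      rintro ⟨h1, h2⟩
      exact hQ ⟨h1.anti hG', fun ⟨x, hx, hadj⟩ => h2 ⟨x, hx, hG' hadj⟩⟩
  · intro G _ hs hQ
    unfold indic
    rw [if_pos ⟨hs, hQ⟩, div_le_one (by linarith)]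
    exact hn

/-- A vertex with many neighbors among the neighbors of `u` becomes adjacent to `u`. -/
theorem Decays.adj_center [Nonempty V] {u : V} {d : ℕ} (hd : 0 < d) {H : SimpleGraph V} {w : V}
    (hw : w ≠ u) {K : Finset V} (hKw : K ⊆ nbr H w) (hKu : K ⊆ nbr H u)
    (hK : d ≤ 20 * K.card) : Decays u d H fun G => ∃ x ∈ ({u} : Finset V), G.Adj w x := by
  refine Decays.of_hit (by simpa using hw) fun G hG hs => ?_
  have hn : (1 : ℝ) ≤ Fintype.card V := by exact_mod_cast Fintype.card_pos
  have hd' : (0 : ℝ) < d := by exact_mod_cast hd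
  have hK' : (d : ℝ) ≤ 20 * K.card := by exact_mod_cast hK
  refine le_trans ?_ (le_sum_walkWeight (K := K) (D := 4 * d) (x := 1)
    (hKw.trans (nbr_mono hG w)) zero_le_one ?_ ?_)
  · rw [div_le_div_iff₀ (by positivity) (by positivity)]
    nlinarith
  · intro v hv
    exact_mod_cast hs.deg_le (Or.inl (hG (mem_nbr.1 (hKu hv))))
  · intro v hv
    have : u ∈ nbr G v ∩ {u} := by
      simpa [mem_nbr] using (hG (mem_nbr.1 (hKu hv))).symm
    exact_mod_cast Finset.card_pos.2 ⟨u, this⟩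

/-- A vertex adjacent to some `y` with many neighbors in `S` becomes adjacent to `S`. -/
theorem Decays.adj_set [Nonempty V] {u : V} {d : ℕ} (hd : 0 < d) {H : SimpleGraph V} {w y : V}
    {S : Finset V} (hw : w ∉ S) (hwy : H.Adj w y) (hy : H.Adj u y ∨ y = u)
    (hS : d ≤ 20 * (nbr H y ∩ S).card) : Decays u d H fun G => ∃ x ∈ S, G.Adj w x := by
  refine Decays.of_hit hw fun G hG hs => ?_
  have hn : (1 : ℝ) ≤ Fintype.card V := by exact_mod_cast Fintype.card_pos
  have hd' : (0 : ℝ) < d := by exact_mod_cast hd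
  refine le_trans ?_ (le_sum_walkWeight (K := {y}) (D := 4 * d) (x := d / 20)
    ?_ (by positivity) ?_ ?_)
  · rw [div_le_div_iff₀ (by positivity) (by positivity)]
    simp only [Finset.card_singleton, Nat.cast_one]
    nlinarith
  · simpa [mem_nbr] using hG hwy
  · intro v hv
    obtain rfl := Finset.mem_singleton.1 hv
    exact_mod_cast hs.deg_le (hy.imp_left fun h => hG h)
  · intro v hv
    obtain rfl := Finset.mem_singleton.1 hv
    have h1 : (nbr H v ∩ S).card ≤ (nbr G v ∩ S).card :=
      Finset.card_le_card (Finset.inter_subset_inter_right (nbr_mono hG v))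
    have h2 : (d : ℝ) ≤ 20 * (nbr G v ∩ S).card := by exact_mod_cast hS.trans (by omega)
    linarith

/-- A vertex adjacent to the densely connected set `S` acquires many neighbors in it. -/
theorem Decays.grow [Nonempty V] {u : V} {d : ℕ} (hd : 0 < d) {H : SimpleGraph V} {w : V}
    {S : Finset V} (hSu : ∀ v ∈ S, H.Adj u v ∨ v = u)
    (hS : ∀ v ∈ S, d < 10 * (nbr H v ∩ S).card) (hw : ∃ s ∈ S, H.Adj w s) :
    Decays u d H fun G => d ≤ 20 * (nbr G w ∩ S).card := by
  have hn : (1 : ℝ) ≤ Fintype.card V := by exact_mod_cast Fintype.card_pos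
  have hd' : (0 : ℝ) < d := by exact_mod_cast hd
  have hmono : ∀ G G' : SimpleGraph V, G ≤ G' → ∀ v,
      (nbr G v ∩ S).card ≤ (nbr G' v ∩ S).card := fun G G' h v =>
    Finset.card_le_card (Finset.inter_subset_inter_right (nbr_mono h v))
  have hpos : ∀ G, H ≤ G → 1 ≤ (nbr G w ∩ S).card := by
    intro G hG
    obtain ⟨s, hs, hadj⟩ := hw
    exact Finset.card_pos.2 ⟨s, Finset.mem_inter.2 ⟨mem_nbr.2 (hG hadj), hs⟩⟩
  set φ : SimpleGraph V → ℝ := fun G =>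
    if SmallBall u d G ∧ ¬ d ≤ 20 * (nbr G w ∩ S).card
    then 1 / ((nbr G w ∩ S).card : ℝ) else 0 with hφ
  refine ⟨φ, ?_, ?_, ?_, ?_⟩
  · intro G; simp only [hφ]; split_ifs <;> positivity
  · simp only [hφ]
    split_ifs
    · have : (1 : ℝ) ≤ (nbr H w ∩ S).card := by exact_mod_cast hpos H le_rfl
      rw [div_le_one (by linarith)]
      exact this
    · exact zero_le_one
  · intro G hG
    by_cases hQ : SmallBall u d G ∧ ¬ d ≤ 20 * (nbr G w ∩ S).card
    · have hφG : φ G = 1 / ((nbr G w ∩ S).card : ℝ) := if_pos hQ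
      rw [hφG]
      obtain ⟨hs, hk⟩ := hQ
      have hwS : w ∉ S := fun hmem => by
        have := hS w hmem
        have := hmono H G hG w
        omega
      have hk1 : (1 : ℝ) ≤ (nbr G w ∩ S).card := by exact_mod_cast hpos G hG
      set k : ℝ := ((nbr G w ∩ S).card : ℝ) with hkdef
      have hle : ∀ G', ∀ j : ℕ, 0 < j → j ≤ (nbr G' w ∩ S).card → φ G' ≤ 1 / (j : ℝ) := by
        intro G' j hj hjk
        have hj' : (0 : ℝ) < j := by exact_mod_cast hj
        have hjk' : (j : ℝ) ≤ (nbr G' w ∩ S).card := by exact_mod_cast hjk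
        simp only [hφ]
        split_ifs
        · gcongr
        · positivity
      have hq := le_sum_walkWeight (G := G) (w := w) (K := nbr G w ∩ S) (X := S \ nbr G w)
        (D := 4 * d) (x := d / 20) Finset.inter_subset_left (by positivity)
        (fun v hv => by
          exact_mod_cast hs.deg_le ((hSu v (Finset.mem_inter.1 hv).2).imp_left fun h => hG h))
        (fun v hv => by
          have h1 := hS v (Finset.mem_inter.1 hv).2
          have h2 := hmono H G hG v
          have h3 : (nbr G v ∩ S).card ≤
              (nbr G v ∩ (S \ nbr G w)).card + (nbr G w ∩ S).card := by
            refine (Finset.card_le_card fun x hx => ?_).trans (Finset.card_union_le _ _)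
            simp only [Finset.mem_union, Finset.mem_inter, Finset.mem_sdiff] at hx ⊢
            tauto
          have h4 : d ≤ 20 * (nbr G v ∩ (S \ nbr G w)).card := by omega
          have h5 : (d : ℝ) ≤ 20 * (nbr G v ∩ (S \ nbr G w)).card := by exact_mod_cast h4
          linarith)
      have key := hopMean_le_of_hit (f := φ) (a := 1 / k) (b := 1 / (k + 1))
        (by gcongr; linarith)
        (fun G' hG' => by
          have := hle G' _ (hpos G hG) (hmono G G' hG' w)
          simpa [hkdef] using this)
        (fun G' hG' x hx hadj => by
          have h1 : (nbr G w ∩ S).card + 1 ≤ (nbr G' w ∩ S).card := by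
            rw [Finset.mem_sdiff] at hx
            refine Finset.card_lt_card (Finset.ssubset_iff_of_subset
              (Finset.inter_subset_inter_right (nbr_mono hG' w)) |>.2 ⟨x, ?_, ?_⟩)
            · exact Finset.mem_inter.2 ⟨mem_nbr.2 hadj, hx.1⟩
            · exact fun h => hx.2 (Finset.mem_inter.1 h).1
          have := hle G' _ (Nat.succ_pos _) h1
          simpa [hkdef] using this)
        (fun h => hwS (Finset.mem_sdiff.1 h).1) hq
      refine key.trans ?_
      have e1 : k * (d / 20) / (Fintype.card V * (4 * d)) * (1 / k - 1 / (k + 1))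
          = 1 / (80 * Fintype.card V * (k + 1)) := by
        field_simp
        norm_num
      have e2 : 1 / (160 * (Fintype.card V : ℝ)) * (1 / k)
          ≤ 1 / (80 * Fintype.card V * (k + 1)) := by
        rw [one_div_mul_one_div]
        refine one_div_le_one_div_of_le (by positivity) ?_
        nlinarith
      rw [← hkdef, e1]
      linarith
    · have h0 : φ G = 0 := if_neg hQ
      rw [h0, mul_zero]
      refine (hopMean_mono (g := fun _ => 0) fun G' hG' => ?_).trans (by simp [hopMean])
      simp only [hφ]
      rw [if_neg]
      rintro ⟨h1, h2⟩
      exact hQ ⟨h1.anti hG', fun h => h2 (h.trans (by have := hmono G G' hG' w; omega))⟩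
  · intro G hG hs hQ
    have hφG : φ G = 1 / ((nbr G w ∩ S).card : ℝ) := if_pos ⟨hs, hQ⟩
    rw [hφG]
    have h1 : (0 : ℝ) < (nbr G w ∩ S).card := by exact_mod_cast hpos G hG
    have h2 : ((nbr G w ∩ S).card : ℝ) ≤ Fintype.card V := by
      exact_mod_cast Finset.card_le_univ _
    gcongr

/-- The failure probability of a stage of `L` rounds. -/
def stageError (n L : ℕ) : ℝ := n * (n * (1 - 1 / (160 * (n : ℝ))) ^ L)

theorem iterate_indic_nonneg [Nonempty V] (E : SimpleGraph V → Prop) (t : ℕ)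
    (G : SimpleGraph V) : 0 ≤ hopMean^[t] (indic E) G := by
  rw [← iterate_hopMean_const t 0 G]
  exact iterate_hopMean_mono t fun G' _ => by unfold indic; split_ifs <;> norm_num

theorem iterate_indic_le_one [Nonempty V] (E : SimpleGraph V → Prop) (t : ℕ)
    (G : SimpleGraph V) : hopMean^[t] (indic E) G ≤ 1 := by
  rw [← iterate_hopMean_const t 1 G]
  exact iterate_hopMean_mono t fun G' _ => by unfold indic; split_ifs <;> norm_num

theorem iterate_indic_eq_zero [Nonempty V] {E : SimpleGraph V → Prop} {G : SimpleGraph V}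
    (h : ∀ G', G ≤ G' → ¬ E G') (t : ℕ) : hopMean^[t] (indic E) G = 0 := by
  refine le_antisymm ?_ (iterate_indic_nonneg E t G)
  rw [← iterate_hopMean_const t 0 G]
  exact iterate_hopMean_mono t fun G' hG' => by simp [indic, h G' hG']

/-- Run the process for `L` rounds; either some decaying failure persists or all `Q w` hold. -/
theorem iterate_indic_le_of_decays [Nonempty V] {u : V} {d : ℕ} {E : SimpleGraph V → Prop}
    {H : SimpleGraph V} (hE : ∀ G, H ≤ G → E G → SmallBall u d G) {Q : V → SimpleGraph V → Prop}
    (hQ : ∀ w, Decays u d H (Q w)) {L R : ℕ} {B : ℝ} (hB0 : 0 ≤ B)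
    (hB : ∀ G, H ≤ G → SmallBall u d G → (∀ w, Q w G) → hopMean^[R] (indic E) G ≤ B) :
    hopMean^[L + R] (indic E) H ≤ stageError (Fintype.card V) L + B := by
  have hn : (1 : ℝ) ≤ Fintype.card V := by exact_mod_cast Fintype.card_pos
  choose φ h0 h1 hdec hfail using hQ
  have hpt : ∀ G, H ≤ G →
      hopMean^[R] (indic E) G ≤ (∑ w, (Fintype.card V : ℝ) * φ w G) + B := by
    intro G hG
    have hsum : 0 ≤ ∑ w, (Fintype.card V : ℝ) * φ w G :=
      Finset.sum_nonneg fun w _ => mul_nonneg (by linarith) (h0 w G)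
    by_cases hs : SmallBall u d G
    · by_cases hall : ∀ w, Q w G
      · linarith [hB G hG hs hall]
      · push Not at hall
        obtain ⟨w, hw⟩ := hall
        have h2 := hfail w G hG hs hw
        have h3 : (1 : ℝ) ≤ Fintype.card V * φ w G := by
          rw [div_le_iff₀ (by linarith)] at h2
          linarith
        have h4 := Finset.single_le_sum (f := fun w => (Fintype.card V : ℝ) * φ w G)
          (fun w _ => mul_nonneg (by linarith) (h0 w G)) (Finset.mem_univ w)
        have h5 := iterate_indic_le_one E R G
        linarith
    · rw [iterate_indic_eq_zero fun G' hG' hEG => hs ((hE G' (hG.trans hG') hEG).anti hG')]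
      linarith
  rw [Function.iterate_add_apply]
  refine (iterate_hopMean_mono L hpt).trans ?_
  rw [iterate_hopMean_add L (fun G => ∑ w, (Fintype.card V : ℝ) * φ w G) (fun _ => B),
    iterate_hopMean_sum L Finset.univ (fun w G => (Fintype.card V : ℝ) * φ w G)]
  simp only [iterate_hopMean_const]
  gcongr
  have hw : ∀ w ∈ (Finset.univ : Finset V),
      hopMean^[L] (fun G => (Fintype.card V : ℝ) * φ w G) H ≤
        Fintype.card V * (1 - 1 / (160 * (Fintype.card V : ℝ))) ^ L := by
    intro w _
    rw [iterate_hopMean_const_mul]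
    have h2 := iterate_hopMean_le_pow one_sub_rate_nonneg (hdec w) L H le_rfl
    have h3 := mul_le_mul_of_nonneg_left (h1 w) (pow_nonneg (one_sub_rate_nonneg (V := V)) L)
    simp only
    gcongr
    linarith
  refine (Finset.sum_le_sum hw).trans ?_
  simp [stageError]

theorem stageError_nonneg [Nonempty V] (L : ℕ) : 0 ≤ stageError (Fintype.card V) L := by
  have := one_sub_rate_nonneg (V := V)
  unfold stageError
  positivity

/-- A graph with many edges inside `A` has a nonempty part of large minimum degree. -/
theorem exists_dense_core (F : SimpleGraph V) (d : ℕ) (A : Finset V)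
    (h : d * A.card < 5 * ∑ a ∈ A, (nbr F a ∩ A).card) :
    ∃ S : Finset V, S.Nonempty ∧ ∀ v ∈ S, d < 10 * (nbr F v ∩ S).card := by
  induction A using Finset.strongInduction with
  | H A ih =>
    by_cases hall : ∀ v ∈ A, d < 10 * (nbr F v ∩ A).card
    · refine ⟨A, ?_, hall⟩
      rw [Finset.nonempty_iff_ne_empty]
      rintro rfl
      simp at h
    · push Not at hall
      obtain ⟨v, hv, hle⟩ := hall
      refine ih (A.erase v) (Finset.erase_ssubset hv) ?_
      have h1 : ∀ a ∈ A.erase v, (nbr F a ∩ A).card =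
          (nbr F a ∩ A.erase v).card + if a ∈ nbr F v then 1 else 0 := by
        intro a _
        have hva : v ∈ nbr F a ↔ a ∈ nbr F v := by simp [mem_nbr, F.adj_comm]
        rw [Finset.inter_erase]
        split_ifs with hc
        · exact (Finset.card_erase_add_one (Finset.mem_inter.2 ⟨hva.2 hc, hv⟩)).symm
        · rw [Finset.erase_eq_of_notMem fun hm => hc (hva.1 (Finset.mem_inter.1 hm).1), add_zero]
      have h2 : ∑ a ∈ A.erase v, (if a ∈ nbr F v then 1 else 0) ≤ (nbr F v ∩ A).card := by
        rw [← Finset.card_filter]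
        refine Finset.card_le_card fun a ha => ?_
        simp only [Finset.mem_filter, Finset.mem_erase, Finset.mem_inter] at ha ⊢
        tauto
      have h3 := Finset.add_sum_erase A (fun a => (nbr F a ∩ A).card) hv
      rw [Finset.sum_congr rfl h1, Finset.sum_add_distrib] at h3
      have h4 := Finset.card_erase_add_one hv
      rw [← h4, mul_add, mul_one] at h
      omega

/-- A small ball contains a set of large internal minimum degree all of whose members outside
the neighborhood of `u` have many neighbors inside it. -/
theorem exists_core_of_smallBall {G : SimpleGraph V} {u : V} {d : ℕ} (hd : 0 < d)
    (hdeg : ∀ v, d ≤ deg G v) (hs : SmallBall u d G) :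
    ∃ S : Finset V, S.Nonempty ∧ (∀ v ∈ S, d < 10 * (nbr G v ∩ S).card) ∧
      ∀ v ∈ S, ¬ G.Adj u v → d < 10 * (nbr G v ∩ S ∩ nbr G u).card := by
  let F : SimpleGraph V :=
    { Adj := fun a b => G.Adj a b ∧ (G.Adj u a ∨ G.Adj u b)
      symm := ⟨fun a b h => ⟨h.1.symm, h.2.symm⟩⟩
      loopless := ⟨fun a h => G.irrefl h.1⟩ }
  have hF : ∀ a b, b ∈ nbr F a ↔ G.Adj a b ∧ (G.Adj u a ∨ G.Adj u b) := fun a b => mem_nbr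
  obtain ⟨S, hne, hS⟩ := exists_dense_core F d (reach2 G u) (by
    have h1 : ∀ a ∈ nbr G u, d ≤ (nbr F a ∩ reach2 G u).card := by
      intro a ha
      refine (hdeg a).trans (Finset.card_le_card fun b hb => ?_)
      rw [mem_nbr] at ha hb
      exact Finset.mem_inter.2 ⟨(hF a b).2 ⟨hb, Or.inl ha⟩, mem_reach2.2 (Or.inr ⟨a, ha, hb⟩)⟩
    have h2 : (nbr G u).card * d ≤ ∑ a ∈ reach2 G u, (nbr F a ∩ reach2 G u).card := by
      refine le_trans ?_ (Finset.sum_le_sum_of_subset (Finset.subset_union_left (s₁ := nbr G u)))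
      simpa using Finset.sum_le_sum h1
    have h3 : d * d ≤ (nbr G u).card * d := Nat.mul_le_mul_right d (hdeg u)
    have h4 : d * (reach2 G u).card ≤ d * (4 * d) := Nat.mul_le_mul_left d hs
    nlinarith)
  refine ⟨S, hne, fun v hv => (hS v hv).trans_le ?_, fun v hv hnv => (hS v hv).trans_le ?_⟩
  · refine Nat.mul_le_mul_left 10 (Finset.card_le_card (Finset.inter_subset_inter_right ?_))
    intro b hb
    exact mem_nbr.2 ((hF v b).1 hb).1
  · refine Nat.mul_le_mul_left 10 (Finset.card_le_card fun b hb => ?_)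
    obtain ⟨hb1, hb2⟩ := Finset.mem_inter.1 hb
    obtain ⟨hadj, h | h⟩ := (hF v b).1 hb1
    · exact absurd h hnv
    · exact Finset.mem_inter.2 ⟨Finset.mem_inter.2 ⟨mem_nbr.2 hadj, hb2⟩, mem_nbr.2 h⟩

theorem Decays.imp {u : V} {d : ℕ} {H : SimpleGraph V} {Q Q' : SimpleGraph V → Prop}
    (h : Decays u d H Q) (hQ : ∀ G, H ≤ G → Q G → Q' G) : Decays u d H Q' := by
  obtain ⟨φ, h0, h1, h2, h3⟩ := h
  exact ⟨φ, h0, h1, h2, fun G hG hs hn => h3 G hG hs fun h => hn (hQ G hG h)⟩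

/-- A densely connected set of vertices lying in the closed neighborhood of `u`. -/
structure IsCore (u : V) (d : ℕ) (S : Finset V) (G : SimpleGraph V) : Prop where
  nonempty : S.Nonempty
  near : ∀ v ∈ S, G.Adj u v ∨ v = u
  dense : ∀ v ∈ S, d < 10 * (nbr G v ∩ S).card

theorem card_nbr_inter_mono {G G' : SimpleGraph V} (h : G ≤ G') (S : Finset V) (v : V) :
    (nbr G v ∩ S).card ≤ (nbr G' v ∩ S).card :=
  Finset.card_le_card (Finset.inter_subset_inter_right (nbr_mono h v))

theorem IsCore.mono {u : V} {d : ℕ} {S : Finset V} {G G' : SimpleGraph V} (h : G ≤ G')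
    (hS : IsCore u d S G) : IsCore u d S G' where
  nonempty := hS.nonempty
  near v hv := (hS.near v hv).imp_left fun h' => h h'
  dense v hv := (hS.dense v hv).trans_le
    (Nat.mul_le_mul_left 10 (card_nbr_inter_mono h S v))

theorem IsCore.decays_grow [Nonempty V] {u : V} {d : ℕ} (hd : 0 < d) {S : Finset V}
    {H : SimpleGraph V} (hS : IsCore u d S H) {w : V} (hw : w ∈ S ∨ ∃ s ∈ S, H.Adj w s) :
    Decays u d H fun G => d ≤ 20 * (nbr G w ∩ S).card := by
  rcases hw with hw | hw
  · refine Decays.of_holds fun G hG => ?_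
    have := (hS.mono hG).dense w hw
    omega
  · exact Decays.grow hd hS.near hS.dense hw

theorem IsCore.decays_adj_nbr [Nonempty V] {u : V} {d : ℕ} (hd : 0 < d) {S : Finset V}
    {H : SimpleGraph V} (hS : IsCore u d S H) {w : V} (hw : H.Adj u w) :
    Decays u d H fun G => w ∈ S ∨ ∃ s ∈ S, G.Adj w s := by
  by_cases hwS : w ∈ S
  · exact Decays.of_holds fun G _ => Or.inl hwS
  by_cases huS : u ∈ S
  · exact Decays.of_holds fun G hG => Or.inr ⟨u, huS, hG hw.symm⟩
  refine (Decays.adj_set hd hwS hw.symm (Or.inr rfl) ?_).imp fun G _ h => Or.inr h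
  have hsub : nbr H u ∩ S = S := Finset.inter_eq_right.2 fun s hs =>
    mem_nbr.2 ((hS.near s hs).resolve_right fun h => huS (h ▸ hs))
  obtain ⟨s, hs⟩ := hS.nonempty
  have h1 := hS.dense s hs
  have h2 : (nbr H s ∩ S).card ≤ S.card := Finset.card_le_card Finset.inter_subset_right
  rw [hsub]
  omega

theorem IsCore.decays_adj_center [Nonempty V] {u : V} {d : ℕ} (hd : 0 < d) {S : Finset V}
    {H : SimpleGraph V} (hS : IsCore u d S H) {w : V} (hwu : w ≠ u)
    (hw : d ≤ 20 * (nbr H w ∩ S).card) : Decays u d H fun G => G.Adj u w := by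
  by_cases h : H.Adj u w
  · exact Decays.of_holds fun G hG => hG h
  refine (Decays.adj_center hd hwu (K := nbr H w ∩ S) Finset.inter_subset_left ?_ hw).imp ?_
  · intro s hs
    obtain ⟨h1, h2⟩ := Finset.mem_inter.1 hs
    refine mem_nbr.2 ((hS.near s h2).resolve_right ?_)
    rintro rfl
    exact h (mem_nbr.1 h1).symm
  · intro G _ hG
    simpa [G.adj_comm u w] using hG

/-- After five stages the whole ball of radius two has become adjacent to `u`. -/
theorem iterate_indic_le_of_core [Nonempty V] {u : V} {d : ℕ} (hd : 0 < d)
    {E : SimpleGraph V → Prop} {H : SimpleGraph V} {S : Finset V} (hS : IsCore u d S H)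
    (hE : ∀ G, H ≤ G → E G → SmallBall u d G) {L R : ℕ} {B : ℝ} (hB0 : 0 ≤ B)
    (hB : ∀ G, H ≤ G → (∀ w ∈ reach2 H u, w ≠ u → G.Adj u w) → hopMean^[R] (indic E) G ≤ B) :
    hopMean^[5 * L + R] (indic E) H ≤ 5 * stageError (Fintype.card V) L + B := by
  have he := stageError_nonneg (V := V) L
  rw [show 5 * L + R = L + (L + (L + (L + (L + R)))) by ring,
    show 5 * stageError (Fintype.card V) L + B = stageError (Fintype.card V) L +
      (stageError (Fintype.card V) L + (stageError (Fintype.card V) L +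
      (stageError (Fintype.card V) L + (stageError (Fintype.card V) L + B)))) by ring]
  refine iterate_indic_le_of_decays hE
    (Q := fun w G => H.Adj u w → w ∈ S ∨ ∃ s ∈ S, G.Adj w s) (fun w => ?_) (by positivity)
    fun G₁ h₁ _ hQ₁ => ?_
  · by_cases hw : H.Adj u w
    · exact (hS.decays_adj_nbr hd hw).imp fun _ _ h _ => h
    · exact Decays.of_holds fun _ _ h => absurd h hw
  refine iterate_indic_le_of_decays (fun G hG => hE G (h₁.trans hG))
    (Q := fun w G => H.Adj u w → d ≤ 20 * (nbr G w ∩ S).card) (fun w => ?_) (by positivity)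
    fun G₂ h₂ _ hQ₂ => ?_
  · by_cases hw : H.Adj u w
    · exact ((hS.mono h₁).decays_grow hd (hQ₁ w hw)).imp fun _ _ h _ => h
    · exact Decays.of_holds fun _ _ h => absurd h hw
  have h₂' := h₁.trans h₂
  refine iterate_indic_le_of_decays (fun G hG => hE G (h₂'.trans hG))
    (Q := fun w G => w ∈ reach2 H u → w ∈ S ∨ ∃ s ∈ S, G.Adj w s) (fun w => ?_)
    (by positivity) fun G₃ h₃ _ hQ₃ => ?_
  · by_cases hwS : w ∈ S
    · exact Decays.of_holds fun _ _ _ => Or.inl hwS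
    by_cases hw : w ∈ reach2 H u
    · rcases mem_reach2.1 hw with hw | ⟨v, huv, hvw⟩
      · have hpos : 0 < (nbr G₂ w ∩ S).card := by have := hQ₂ w hw; omega
        obtain ⟨s, hs⟩ := Finset.card_pos.1 hpos
        obtain ⟨hs1, hs2⟩ := Finset.mem_inter.1 hs
        exact Decays.of_holds fun G hG _ => Or.inr ⟨s, hs2, hG (mem_nbr.1 hs1)⟩
      · exact (Decays.adj_set hd hwS (h₂' hvw.symm) (Or.inl (h₂' huv)) (hQ₂ v huv)).imp
          fun _ _ h _ => Or.inr h
    · exact Decays.of_holds fun _ _ h => absurd h hw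
  have h₃' := h₂'.trans h₃
  refine iterate_indic_le_of_decays (fun G hG => hE G (h₃'.trans hG))
    (Q := fun w G => w ∈ reach2 H u → d ≤ 20 * (nbr G w ∩ S).card) (fun w => ?_)
    (by positivity) fun G₄ h₄ _ hQ₄ => ?_
  · by_cases hw : w ∈ reach2 H u
    · exact ((hS.mono h₃').decays_grow hd (hQ₃ w hw)).imp fun _ _ h _ => h
    · exact Decays.of_holds fun _ _ h => absurd h hw
  have h₄' := h₃'.trans h₄
  refine iterate_indic_le_of_decays (fun G hG => hE G (h₄'.trans hG))
    (Q := fun w G => w ∈ reach2 H u → w ≠ u → G.Adj u w) (fun w => ?_)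
    hB0 fun G₅ h₅ _ hQ₅ => hB G₅ (h₄'.trans h₅) hQ₅
  by_cases hw : w ∈ reach2 H u
  · by_cases hwu : w = u
    · exact Decays.of_holds fun _ _ _ h => absurd hwu h
    · exact ((hS.mono h₄').decays_adj_center hd hwu (hQ₄ w hw)).imp fun _ _ h _ _ => h
  · exact Decays.of_holds fun _ _ h => absurd h hw

/-- Three successive absorptions of the ball of radius two complete `u` or double its degree. -/
theorem le_deg_of_absorb {u : V} {d : ℕ} {G₁ G₂ G₃ G₄ : SimpleGraph V} (hc : G₁.Connected)
    (hd : 0 < d) (hdeg : ∀ v, d ≤ deg G₁ v) (h₁₂ : G₁ ≤ G₂) (h₂₃ : G₂ ≤ G₃) (h₃₄ : G₃ ≤ G₄)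
    (h₁ : ∀ w ∈ reach2 G₁ u, w ≠ u → G₂.Adj u w) (h₂ : ∀ w ∈ reach2 G₂ u, w ≠ u → G₃.Adj u w)
    (h₃ : ∀ w ∈ reach2 G₃ u, w ≠ u → G₄.Adj u w) :
    2 * d ≤ deg G₄ u ∨ Fintype.card V - 1 ≤ deg G₄ u := by
  by_cases hall : ∀ w, w ∈ reach2 G₁ u
  · right
    have : Finset.univ.erase u ⊆ nbr G₄ u := fun w hw =>
      mem_nbr.2 (h₃₄ (h₂₃ (h₁ w (hall w) (Finset.ne_of_mem_erase hw))))
    simpa [deg] using Finset.card_le_card this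
  left
  push Not at hall
  obtain ⟨z₀, hz₀⟩ := hall
  have hu : u ∈ reach2 G₁ u := by
    obtain ⟨v, hv⟩ := Finset.card_pos.1 (hd.trans_le (hdeg u))
    exact mem_reach2.2 (Or.inr ⟨v, mem_nbr.1 hv, (mem_nbr.1 hv).symm⟩)
  obtain ⟨p⟩ := hc.preconnected u z₀
  obtain ⟨e, -, he1, he2⟩ := p.exists_boundary_dart (reach2 G₁ u : Set V) hu hz₀
  obtain ⟨⟨w, z⟩, hwz⟩ := e
  simp only [Finset.mem_coe] at he1 he2 hwz
  have hwu : w ≠ u := by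
    rintro rfl
    exact he2 (mem_reach2.2 (Or.inl hwz))
  have hzu : z ≠ u := by
    rintro rfl
    exact he2 hu
  have hz3 : G₃.Adj u z :=
    h₂ z (mem_reach2.2 (Or.inr ⟨w, h₁ w he1 hwu, h₁₂ hwz⟩)) hzu
  have hdisj : Disjoint (nbr G₁ u) (nbr G₁ z) := by
    rw [Finset.disjoint_left]
    intro x hx hx'
    exact he2 (mem_reach2.2 (Or.inr ⟨x, mem_nbr.1 hx, (mem_nbr.1 hx').symm⟩))
  have hsub : nbr G₁ u ∪ nbr G₁ z ⊆ nbr G₄ u := by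
    refine Finset.union_subset (nbr_mono (h₁₂.trans (h₂₃.trans h₃₄)) u) fun x hx => ?_
    rw [mem_nbr] at hx
    refine mem_nbr.2 (h₃ x (mem_reach2.2 (Or.inr ⟨z, hz3, (h₁₂.trans h₂₃) hx⟩)) ?_)
    rintro rfl
    exact he2 (mem_reach2.2 (Or.inl hx.symm))
  have := Finset.card_le_card hsub
  rw [Finset.card_union_of_disjoint hdisj] at this
  have h4 := hdeg u
  have h5 := hdeg z
  unfold deg at *
  omega

theorem iterate_indic_le_stageError [Nonempty V] {u : V} {d : ℕ} (hd : 0 < d)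
    {E : SimpleGraph V → Prop} {G₀ : SimpleGraph V} (hc : G₀.Connected)
    (hdeg : ∀ v, d ≤ deg G₀ v) (hE : ∀ G, G₀ ≤ G → E G → SmallBall u d G)
    (hE' : ∀ G, G₀ ≤ G → E G → deg G u < 2 * d ∧ deg G u < Fintype.card V - 1) (L R : ℕ) :
    hopMean^[16 * L + R] (indic E) G₀ ≤ 16 * stageError (Fintype.card V) L := by
  have he := stageError_nonneg (V := V) L
  by_cases hs : SmallBall u d G₀
  swap
  · rw [iterate_indic_eq_zero fun G hG hEG => hs ((hE G hG hEG).anti hG)]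
    positivity
  obtain ⟨S, hne, hS, hS'⟩ := exists_core_of_smallBall hd hdeg hs
  rw [show 16 * L + R = L + (5 * L + (5 * L + (5 * L + R))) by ring,
    show 16 * stageError (Fintype.card V) L = stageError (Fintype.card V) L +
      (5 * stageError (Fintype.card V) L + (5 * stageError (Fintype.card V) L +
      (5 * stageError (Fintype.card V) L + 0))) by ring]
  refine iterate_indic_le_of_decays hE (Q := fun w G => w ∈ S → G.Adj u w ∨ w = u)
    (fun w => ?_) (by positivity) fun G₁ h₁ _ hQ => ?_
  · by_cases hwS : w ∈ S
    swap
    · exact Decays.of_holds fun _ _ h => absurd h hwS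
    by_cases hwu : w = u
    · exact Decays.of_holds fun _ _ _ => Or.inr hwu
    by_cases hadj : G₀.Adj u w
    · exact Decays.of_holds fun _ hG _ => Or.inl (hG hadj)
    refine (Decays.adj_center hd hwu (K := nbr G₀ w ∩ S ∩ nbr G₀ u)
      (Finset.inter_subset_left.trans Finset.inter_subset_left) Finset.inter_subset_right
      (by have := hS' w hwS hadj; omega)).imp ?_
    intro G _ hG _
    left
    simpa [G.adj_comm u w] using hG
  have hcore : IsCore u d S G₁ := ⟨hne, hQ, fun v hv => (hS v hv).trans_le
    (Nat.mul_le_mul_left 10 (card_nbr_inter_mono h₁ S v))⟩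
  refine iterate_indic_le_of_core hd hcore (fun G hG => hE G (h₁.trans hG)) (by positivity)
    fun G₂ h₂ hr₁ => ?_
  have h₂' := h₁.trans h₂
  refine iterate_indic_le_of_core hd (hcore.mono h₂) (fun G hG => hE G (h₂'.trans hG))
    (by positivity) fun G₃ h₃ hr₂ => ?_
  have h₃' := h₂'.trans h₃
  refine iterate_indic_le_of_core hd (hcore.mono (h₂.trans h₃))
    (fun G hG => hE G (h₃'.trans hG)) le_rfl fun G₄ h₄ hr₃ => ?_
  refine (iterate_indic_eq_zero (fun G hG hEG => ?_) R).le
  have hfin := le_deg_of_absorb (hc.mono h₁) hd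
    (fun v => (hdeg v).trans (Finset.card_le_card (nbr_mono h₁ v))) h₂ h₃ h₄ hr₁ hr₂ hr₃
  have hmono : deg G₄ u ≤ deg G u := Finset.card_le_card (nbr_mono hG u)
  have := hE' G (h₃'.trans (h₄.trans hG)) hEG
  omega

theorem reach2_subset {G : SimpleGraph V} (u : V) :
    reach2 G u ⊆ insert u (nbr G u ∪ Nk G u 2) := by
  intro w hw
  by_cases hwu : w = u
  · simp [hwu]
  rcases mem_reach2.1 hw with h | ⟨v, h1, h2⟩
  · simp [mem_nbr, h]
  by_cases h : G.Adj u w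
  · simp [mem_nbr, h]
  have hle : G.dist u w ≤ 2 := by
    simpa using SimpleGraph.dist_le (SimpleGraph.Walk.cons h1 (SimpleGraph.Walk.cons h2 .nil))
  have hne0 : G.dist u w ≠ 0 := by
    have hr : G.Reachable u w := h1.reachable.trans h2.reachable
    exact (hr.pos_dist_of_ne (Ne.symm hwu)).ne'
  have hne1 : G.dist u w ≠ 1 := fun hh => h (SimpleGraph.dist_eq_one_iff_adj.1 hh)
  have : G.dist u w = 2 := by omega
  simp [Nk, hwu, this]

theorem stageError_le {n L : ℕ} (hn : 2 ≤ n) (hL : 1600 * n * Real.log n ≤ L) :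
    16 * stageError n L ≤ 1 / (n : ℝ) ^ 2 := by
  have hn' : (2 : ℝ) ≤ n := by exact_mod_cast hn
  have hpos : (0 : ℝ) < n := by linarith
  have h1 : (1 - 1 / (160 * (n : ℝ))) ^ L ≤ 1 / (n : ℝ) ^ 10 := by
    have hb : 1 - 1 / (160 * (n : ℝ)) ≤ Real.exp (-(1 / (160 * n))) := by
      have := Real.add_one_le_exp (-(1 / (160 * (n : ℝ))))
      linarith
    have hb0 : 0 ≤ 1 - 1 / (160 * (n : ℝ)) := by
      rw [sub_nonneg, div_le_one (by positivity)]
      linarith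
    calc (1 - 1 / (160 * (n : ℝ))) ^ L ≤ Real.exp (-(1 / (160 * n))) ^ L := by gcongr
      _ = Real.exp (-(L / (160 * n))) := by
        rw [← Real.exp_nat_mul]
        congr 1
        ring
      _ ≤ Real.exp (-(10 * Real.log n)) := by
        rw [Real.exp_le_exp, neg_le_neg_iff, le_div_iff₀ (by positivity)]
        linarith
      _ = 1 / (n : ℝ) ^ 10 := by
        rw [Real.exp_neg, one_div, show (10 : ℝ) * Real.log n = ((10 : ℕ) : ℝ) * Real.log n by
          norm_num, Real.exp_nat_mul, Real.exp_log hpos]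
  have h2 : (2 : ℝ) ^ 6 ≤ (n : ℝ) ^ 6 := by gcongr
  calc 16 * stageError n L ≤ 16 * (n * (n * (1 / (n : ℝ) ^ 10))) := by
        unfold stageError
        gcongr
    _ = 16 / (n : ℝ) ^ 6 * (1 / (n : ℝ) ^ 2) := by field_simp
    _ ≤ 1 * (1 / (n : ℝ) ^ 2) := by
        gcongr
        rw [div_le_one (by positivity)]
        linarith
    _ = 1 / (n : ℝ) ^ 2 := one_mul _

end

/-- There is a constant `C > 0` such that for every `n ≥ 2`, every
connected initial graph `G₀` on `n` vertices with minimum degree `δ₀`, and every vertex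
`u`, with `T = ⌈C·n·ln n⌉`: the probability, over the trajectory of the two-hop walk
process started at `G₀`, that both `|N_T²(u)| < δ₀/2` and
`d_T(u) < min {2δ₀, n − 1}`, is at most `1/n²`. -/
theorem twoHop_small_second_neighborhood :
    ∃ C : ℝ, 0 < C ∧
      ∀ (V : Type) [Fintype V] [DecidableEq V] (n : ℕ), 2 ≤ n → Fintype.card V = n →
        ∀ (G0 : SimpleGraph V), G0.Connected → ∀ u : V,
          ∀ T : ℕ, T = ⌈C * n * Real.log n⌉₊ →
            trajProb hopStep G0 T (fun g =>
              ((Nk (g T) u 2).card : ℝ) < (minDeg G0 : ℝ) / 2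
              ∧ (deg (g T) u : ℝ) < min (2 * (minDeg G0 : ℝ)) ((n : ℝ) - 1))
            ≤ 1 / (n : ℝ) ^ 2 := by
  refine ⟨51200, by norm_num, ?_⟩
  rintro V _ _ n hn rfl G0 hc u T hT
  set n := Fintype.card V
  have : Nonempty V := ⟨u⟩
  have : Nontrivial V := Fintype.one_lt_card_iff_nontrivial.1 hn
  have hdeg : ∀ v, minDeg G0 ≤ deg G0 v := fun v => Nat.sInf_le ⟨v, rfl⟩
  have hd : 0 < minDeg G0 := by
    obtain ⟨v, hv⟩ : minDeg G0 ∈ Set.range (deg G0) := Nat.sInf_mem (Set.range_nonempty _)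
    obtain ⟨w, hw⟩ := hc.preconnected.exists_adj_of_nontrivial v
    rw [← hv]
    exact deg_pos_of_adj hw
  have hn' : (2 : ℝ) ≤ n := by exact_mod_cast hn
  have hx : 1 ≤ 1600 * (n : ℝ) * Real.log n := by
    have h1 := Real.log_two_gt_d9
    have h2 : Real.log 2 ≤ Real.log n := Real.log_le_log (by norm_num) hn'
    nlinarith
  set L := ⌈1600 * (n : ℝ) * Real.log n⌉₊ with hL
  have hLT : 16 * L ≤ T := by
    have h1 := (Nat.ceil_lt_add_one (a := 1600 * (n : ℝ) * Real.log n) (by linarith)).le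
    have h2 : 51200 * (n : ℝ) * Real.log n ≤ T := hT ▸ Nat.le_ceil _
    have h3 : ((16 * L : ℕ) : ℝ) ≤ T := by
      push_cast
      linarith
    exact_mod_cast h3
  obtain ⟨R, rfl⟩ := Nat.exists_eq_add_of_le hLT
  rw [trajProb_hopStep (16 * L + R) (fun G =>
    ((Nk G u 2).card : ℝ) < (minDeg G0 : ℝ) / 2
      ∧ (deg G u : ℝ) < min (2 * (minDeg G0 : ℝ)) ((n : ℝ) - 1))]
  refine (iterate_indic_le_stageError (u := u) hd hc hdeg ?_ ?_ L R).trans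
    (stageError_le hn (Nat.le_ceil _))
  · rintro G - ⟨h1, h2⟩
    have h3 : deg G u < 2 * minDeg G0 := by exact_mod_cast h2.trans_le (min_le_left _ _)
    have h4 : 2 * (Nk G u 2).card < minDeg G0 := by
      have : 2 * ((Nk G u 2).card : ℝ) < minDeg G0 := by linarith
      exact_mod_cast this
    have h5 := (Finset.card_le_card (reach2_subset (G := G) u)).trans (Finset.card_insert_le _ _)
    have h6 := Finset.card_union_le (nbr G u) (Nk G u 2)
    unfold deg at h3
    unfold SmallBall
    omega
  · rintro G - ⟨-, h2⟩
    refine ⟨by exact_mod_cast h2.trans_le (min_le_left _ _), ?_⟩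
    have h3 : (deg G u : ℝ) < (n : ℝ) - 1 := h2.trans_le (min_le_right _ _)
    have h4 : deg G u + 1 < n := by
      have : (deg G u : ℝ) + 1 < n := by linarith
      exact_mod_cast this
    omega
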